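/- arXiv:1804.03273 — 8 statements merged into one kernel-verified Lean document; each statement's English description precedes it below -/
import Mathlib

section
/- Let Ω₀ be a real symmetric positive semidefinite n×n matrix, C a real m×n matrix, and σ > 0. For a subset S of row indices let Ω(S) = Ω₀ + σ⁻² C_Sᵀ C_S, and when Ω(S) is invertible let Σ(S) = Ω(S)⁻¹ and f(S) = tr Σ(S). If Ω(S) and Ω(S ∪ {v}) are both invertible for some index v ∉ S, then f(S) − f(S ∪ {v}) = ‖Σ(S) C_vᵀ‖² / (σ² + C_v Σ(S) C_vᵀ), where C_v denotes the v-th row of C and ‖·‖ is the Euclidean norm. -/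
open Matrix

/-- The submatrix of `C` consisting of the rows indexed by `S`. -/
def rowSub {m n : ℕ} (C : Matrix (Fin m) (Fin n) ℝ) (S : Finset (Fin m)) :
    Matrix {i // i ∈ S} (Fin n) ℝ :=
  C.submatrix Subtype.val id

/-- `Ω(S) = Ω₀ + σ⁻² C_Sᵀ C_S`. -/
noncomputable def OmegaC {m n : ℕ} (Ω₀ : Matrix (Fin n) (Fin n) ℝ)
    (C : Matrix (Fin m) (Fin n) ℝ) (σ : ℝ) (S : Finset (Fin m)) :
    Matrix (Fin n) (Fin n) ℝ :=
  Ω₀ + (σ ^ 2)⁻¹ • ((rowSub C S)ᵀ * rowSub C S)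

theorem OmegaC_insert {m n : ℕ} (Ω₀ : Matrix (Fin n) (Fin n) ℝ)
    (C : Matrix (Fin m) (Fin n) ℝ) (σ : ℝ) (S : Finset (Fin m)) (v : Fin m) (hv : v ∉ S) :
    OmegaC Ω₀ C σ (insert v S) = OmegaC Ω₀ C σ S + (σ ^ 2)⁻¹ • vecMulVec (C v) (C v) := by
  have key : ∀ T : Finset (Fin m), ∀ i j,
      ((rowSub C T)ᵀ * rowSub C T) i j = ∑ k ∈ T, C k i * C k j := by
    intro T i j
    rw [← Finset.sum_coe_sort T (fun k => C k i * C k j)]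
    simp [Matrix.mul_apply, rowSub]
  ext i j
  simp only [OmegaC, Matrix.add_apply, Matrix.smul_apply, key, Finset.sum_insert hv,
    vecMulVec_apply, smul_eq_mul]
  ring

theorem OmegaC_posSemidef {m n : ℕ} (Ω₀ : Matrix (Fin n) (Fin n) ℝ) (hΩ₀ : Ω₀.PosSemidef)
    (C : Matrix (Fin m) (Fin n) ℝ) (σ : ℝ) (S : Finset (Fin m)) :
    (OmegaC Ω₀ C σ S).PosSemidef := by
  unfold OmegaC
  refine hΩ₀.add (Matrix.PosSemidef.smul ?_ (by positivity))
  have := Matrix.posSemidef_conjTranspose_mul_self (rowSub C S)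
  rwa [Matrix.conjTranspose_eq_transpose_of_trivial] at this

/-- decrease of the trace of the posterior covariance when
adding a node `v ∉ S`:
`f(S) − f(S ∪ {v}) = ‖Σ(S) C_vᵀ‖² / (σ² + C_v Σ(S) C_vᵀ)`. -/
theorem trace_decrease_of_add_sample {m n : ℕ}
    (Ω₀ : Matrix (Fin n) (Fin n) ℝ) (hΩ₀ : Ω₀.PosSemidef)
    (C : Matrix (Fin m) (Fin n) ℝ) (σ : ℝ) (hσ : 0 < σ)
    (S : Finset (Fin m)) (v : Fin m) (hv : v ∉ S)
    (hS : IsUnit (OmegaC Ω₀ C σ S))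
    (hSv : IsUnit (OmegaC Ω₀ C σ (insert v S))) :
    (OmegaC Ω₀ C σ S)⁻¹.trace - (OmegaC Ω₀ C σ (insert v S))⁻¹.trace
      = (∑ j, ((OmegaC Ω₀ C σ S)⁻¹.mulVec (C v) j) ^ 2)
        / (σ ^ 2 + C v ⬝ᵥ (OmegaC Ω₀ C σ S)⁻¹.mulVec (C v)) := by
  have hpos := (OmegaC_posSemidef Ω₀ hΩ₀ C σ S).inv
  rw [OmegaC_insert Ω₀ C σ S v hv]
  generalize OmegaC Ω₀ C σ S = A at *
  generalize C v = c at *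
  have hq : 0 ≤ c ⬝ᵥ A⁻¹ *ᵥ c := by
    simpa using hpos.dotProduct_mulVec_nonneg c
  have hsym : c ᵥ* A⁻¹ = A⁻¹ *ᵥ c := by
    have h1 : (A⁻¹)ᵀ = A⁻¹ := by
      have := hpos.isHermitian.eq
      rwa [Matrix.conjTranspose_eq_transpose_of_trivial] at this
    rw [← Matrix.mulVec_transpose, h1]
  have hdet : IsUnit A.det := (Matrix.isUnit_iff_isUnit_det A).1 hS
  have hAx : A *ᵥ (A⁻¹ *ᵥ c) = c := by
    rw [Matrix.mulVec_mulVec, Matrix.mul_nonsing_inv _ hdet, Matrix.one_mulVec]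
  have hAA := Matrix.mul_nonsing_inv _ hdet
  have hσ2 : 0 < σ ^ 2 := by positivity
  generalize hx : A⁻¹ *ᵥ c = x at *
  have hd : σ ^ 2 + c ⬝ᵥ x ≠ 0 := by positivity
  have hinv : (A + (σ ^ 2)⁻¹ • vecMulVec c c)⁻¹
      = A⁻¹ - (σ ^ 2 + c ⬝ᵥ x)⁻¹ • vecMulVec x x := by
    apply Matrix.inv_eq_right_inv
    rw [Matrix.add_mul, Matrix.mul_sub, Matrix.mul_sub, hAA]
    simp only [Matrix.smul_mul, Matrix.mul_smul, Matrix.mul_vecMulVec, Matrix.vecMulVec_mul,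
      hAx, hsym, Matrix.smul_mulVec, Matrix.vecMulVec_mulVec]
    ext i j
    simp only [Matrix.add_apply, Matrix.sub_apply, Matrix.smul_apply, vecMulVec_apply,
      smul_eq_mul, Pi.smul_apply, MulOpposite.smul_eq_mul_unop, MulOpposite.unop_op]
    field_simp
    ring
  rw [hinv, Matrix.trace_sub, Matrix.trace_smul, Matrix.trace_vecMulVec]
  simp only [dotProduct, smul_eq_mul, div_eq_inv_mul, pow_two]
  ring
end

section
/- Let Ω₀ be a real symmetric positive semidefinite n×n matrix, C a real m×n matrix, and σ > 0. For a subset S of row indices let Ω(S) = Ω₀ + σ⁻² C_Sᵀ C_S and, when Ω(S) is invertible, f(S) = tr(Ω(S)⁻¹). If S ⊆ T are subsets such that Ω(S) and Ω(T) are both invertible, then f(T) ≤ f(S); that is, f is a monotonically non-increasing set function on the family of subsets with invertible Ω. -/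
open Matrix

lemma trace_inv_aux {n : ℕ} (A D : Matrix (Fin n) (Fin n) ℝ) (hA : A.PosSemidef)
    (hD : D.PosSemidef) (uA : IsUnit A) (uB : IsUnit (A + D)) :
    (A + D)⁻¹.trace ≤ A⁻¹.trace := by
  have dA : IsUnit A.det := (Matrix.isUnit_iff_isUnit_det A).1 uA
  have dB : IsUnit (A + D).det := (Matrix.isUnit_iff_isUnit_det _).1 uB
  have hB : (A + D)⁻¹.IsHermitian := (hA.add hD).inv.isHermitian
  have h1 : (D + D * A⁻¹ * D).PosSemidef := by
    have := hA.inv.mul_mul_conjTranspose_same D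
    rw [hD.isHermitian.eq] at this
    exact hD.add this
  have h2 := h1.mul_mul_conjTranspose_same (A + D)⁻¹
  rw [hB.eq] at h2
  have e : D + D * A⁻¹ * D = (A + D) * A⁻¹ * (A + D) - (A + D) := by
    simp only [add_mul, mul_add, Matrix.mul_nonsing_inv _ dA, one_mul,
      Matrix.mul_assoc, Matrix.nonsing_inv_mul _ dA, mul_one]
    abel
  have e2 : (A + D)⁻¹ * (D + D * A⁻¹ * D) * (A + D)⁻¹ = A⁻¹ - (A + D)⁻¹ := by
    rw [e]
    generalize A + D = B at dB
    rw [mul_sub, sub_mul, Matrix.nonsing_inv_mul _ dB, one_mul]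
    congr 1
    rw [Matrix.mul_assoc, Matrix.mul_assoc, Matrix.mul_nonsing_inv _ dB, mul_one,
      ← Matrix.mul_assoc, Matrix.nonsing_inv_mul _ dB, one_mul]
  rw [e2] at h2
  have := h2.trace_nonneg
  rw [Matrix.trace_sub] at this
  linarith

lemma rowSub_gram {m n : ℕ} (C : Matrix (Fin m) (Fin n) ℝ) (S : Finset (Fin m)) (i j : Fin n) :
    ((rowSub C S)ᵀ * rowSub C S) i j = ∑ k ∈ S, C k i * C k j := by
  simp only [Matrix.mul_apply, rowSub, Matrix.transpose_apply, Matrix.submatrix_apply, id]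
  exact Finset.sum_coe_sort S (fun k => C k i * C k j)

lemma gram_psd {m n : ℕ} (C : Matrix (Fin m) (Fin n) ℝ) (σ : ℝ) (S : Finset (Fin m)) :
    ((σ ^ 2)⁻¹ • ((rowSub C S)ᵀ * rowSub C S)).PosSemidef := by
  have := Matrix.posSemidef_conjTranspose_mul_self (rowSub C S)
  rw [Matrix.conjTranspose_eq_transpose_of_trivial] at this
  exact this.smul (by positivity)

/-- `f(S) = tr(Ω(S)⁻¹)` is monotonically non-increasing:
if `S ⊆ T` and both `Ω(S)` and `Ω(T)` are invertible then `f(T) ≤ f(S)`. -/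
theorem trace_inv_antitone {m n : ℕ}
    (Ω₀ : Matrix (Fin n) (Fin n) ℝ) (hΩ₀ : Ω₀.PosSemidef)
    (C : Matrix (Fin m) (Fin n) ℝ) (σ : ℝ) (hσ : 0 < σ)
    (S T : Finset (Fin m)) (hST : S ⊆ T)
    (hS : IsUnit (OmegaC Ω₀ C σ S)) (hT : IsUnit (OmegaC Ω₀ C σ T)) :
    (OmegaC Ω₀ C σ T)⁻¹.trace ≤ (OmegaC Ω₀ C σ S)⁻¹.trace := by
  have key : OmegaC Ω₀ C σ T = OmegaC Ω₀ C σ S +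
      (σ ^ 2)⁻¹ • ((rowSub C (T \ S))ᵀ * rowSub C (T \ S)) := by
    unfold OmegaC
    rw [add_assoc, ← smul_add]
    congr 2
    ext i j
    rw [Matrix.add_apply, rowSub_gram, rowSub_gram, rowSub_gram, add_comm,
      Finset.sum_sdiff hST]
  rw [key] at hT ⊢
  exact trace_inv_aux _ _ (hΩ₀.add (gram_psd C σ S)) (gram_psd C σ _) hS hT
end

section
/- Let Ω₀ be a (possibly singular) Stieltjes n×n matrix and σ > 0. For a subset S ⊆ {1,…,n} let Ω(S) = Ω₀ + σ⁻² Σ_{v∈S} e_v e_vᵀ (i.e., the measurement matrix is the identity, C = I), and assume Ω(S) is positive definite for every nonempty S. Let f(S) = tr(Ω(S)⁻¹) for nonempty S. Then f is supermodular on nonempty sets: for all nonempty S ⊆ T ⊆ {1,…,n} and every v ∉ T, f(S) − f(S ∪ {v}) ≥ f(T) − f(T ∪ {v}). -/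
open Matrix

/-- A (possibly singular) Stieltjes matrix: real symmetric positive
semidefinite with non-positive off-diagonal entries. -/
def IsStieltjes {n : ℕ} (M : Matrix (Fin n) (Fin n) ℝ) : Prop :=
  M.PosSemidef ∧ ∀ i j, i ≠ j → M i j ≤ 0

/-- `Ω(S) = Ω₀ + σ⁻² ∑_{v ∈ S} e_v e_vᵀ` (identity measurement matrix). -/
noncomputable def OmegaId {n : ℕ} (Ω₀ : Matrix (Fin n) (Fin n) ℝ) (σ : ℝ)
    (S : Finset (Fin n)) : Matrix (Fin n) (Fin n) ℝ :=
  Ω₀ + (σ ^ 2)⁻¹ • ∑ v ∈ S, Matrix.single v v (1 : ℝ)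

theorem stieltjes_inv_nonneg {n : ℕ} (M : Matrix (Fin n) (Fin n) ℝ) (hM : M.PosDef)
    (ho : ∀ i j, i ≠ j → M i j ≤ 0) (i k : Fin n) : 0 ≤ M⁻¹ i k := by
  have hdet : IsUnit M.det := (Matrix.isUnit_iff_isUnit_det M).1 hM.isUnit
  let x : Fin n → ℝ := fun j => M⁻¹ j k
  let y : Fin n → ℝ := fun j => max (-x j) 0
  have hMx : ∀ i, ∑ j, M i j * x j = (1 : Matrix (Fin n) (Fin n) ℝ) i k := by
    intro i
    rw [← Matrix.mul_nonsing_inv M hdet, Matrix.mul_apply]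
  have hle : ∑ i, y i * ∑ j, M i j * y j ≤ 0 := by
    have h1 : ∀ i, y i * ∑ j, M i j * y j ≤ - (y i * ∑ j, M i j * x j) := by
      intro i
      rw [Finset.mul_sum, Finset.mul_sum, ← Finset.sum_neg_distrib]
      apply Finset.sum_le_sum
      intro j _
      have hyi : 0 ≤ y i := le_max_right _ _
      have hs : 0 ≤ y j + x j := by
        have : -x j ≤ y j := le_max_left _ _
        linarith
      by_cases hij : i = j
      · subst hij
        have : y i * (y i + x i) = 0 := by
          rcases le_total (-x i) 0 with h | h
          · have : y i = 0 := max_eq_right h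
            simp [this]
          · have : y i = -x i := max_eq_left h
            simp [this]
        nlinarith [congrArg (fun t => M i i * t) this]
      · nlinarith [mul_nonneg (mul_nonneg hyi hs) (neg_nonneg.2 (ho i j hij))]
    refine Finset.sum_nonpos fun i _ => (h1 i).trans ?_
    rw [hMx, neg_nonpos]
    refine mul_nonneg (le_max_right _ _) ?_
    rw [Matrix.one_apply]
    split_ifs <;> norm_num
  have hy : y = 0 := by
    by_contra hne
    have := hM.dotProduct_mulVec_pos hne
    simp only [dotProduct, Matrix.mulVec, star_trivial] at this
    linarith
  have h0 : max (-x i) 0 = 0 := congrFun hy i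
  have : -x i ≤ 0 := h0 ▸ le_max_left _ _
  simpa [x] using this

theorem inv_sub_inv_aux {n : ℕ} (A B : Matrix (Fin n) (Fin n) ℝ) (hA : A.PosDef)
    (hB : B.PosDef) : A⁻¹ - B⁻¹ = A⁻¹ * (B - A) * B⁻¹ := by
  have hA' : IsUnit A.det := (Matrix.isUnit_iff_isUnit_det A).1 hA.isUnit
  have hB' : IsUnit B.det := (Matrix.isUnit_iff_isUnit_det B).1 hB.isUnit
  rw [mul_sub, sub_mul, Matrix.mul_assoc, Matrix.mul_nonsing_inv B hB',
    Matrix.nonsing_inv_mul A hA', Matrix.mul_one, Matrix.one_mul]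

theorem omega_off {n : ℕ} (Ω₀ : Matrix (Fin n) (Fin n) ℝ) (hΩ₀ : IsStieltjes Ω₀)
    (σ : ℝ) (S : Finset (Fin n)) (i j : Fin n) (hij : i ≠ j) : OmegaId Ω₀ σ S i j ≤ 0 := by
  have : (∑ v ∈ S, Matrix.single v v (1 : ℝ)) i j = 0 := by
    rw [Matrix.sum_apply]
    refine Finset.sum_eq_zero fun v _ => ?_
    rw [Matrix.single_apply, if_neg]
    rintro ⟨rfl, rfl⟩
    exact hij rfl
  simp only [OmegaId, Matrix.add_apply, Matrix.smul_apply, this, smul_zero, add_zero]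
  exact hΩ₀.2 i j hij

theorem omega_inv_mono {n : ℕ} (Ω₀ : Matrix (Fin n) (Fin n) ℝ) (hΩ₀ : IsStieltjes Ω₀)
    (σ : ℝ) (S T : Finset (Fin n)) (hST : S ⊆ T) (hS : (OmegaId Ω₀ σ S).PosDef)
    (hT : (OmegaId Ω₀ σ T).PosDef) (i j : Fin n) :
    (OmegaId Ω₀ σ T)⁻¹ i j ≤ (OmegaId Ω₀ σ S)⁻¹ i j := by
  rw [← sub_nonneg, ← Matrix.sub_apply, inv_sub_inv_aux _ _ hS hT]
  have hd : ∀ k l, 0 ≤ (OmegaId Ω₀ σ T - OmegaId Ω₀ σ S) k l := by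
    intro k l
    have : OmegaId Ω₀ σ T - OmegaId Ω₀ σ S
        = (σ ^ 2)⁻¹ • ∑ v ∈ T \ S, Matrix.single v v (1 : ℝ) := by
      rw [OmegaId, OmegaId, ← Finset.sum_sdiff hST, smul_add]
      abel
    rw [this, Matrix.smul_apply, Matrix.sum_apply, smul_eq_mul]
    refine mul_nonneg (by positivity) (Finset.sum_nonneg fun v _ => ?_)
    rw [Matrix.single_apply]
    split_ifs <;> norm_num
  rw [Matrix.mul_apply]
  refine Finset.sum_nonneg fun k _ => mul_nonneg ?_
    (stieltjes_inv_nonneg _ hT (omega_off Ω₀ hΩ₀ σ T) k j)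
  rw [Matrix.mul_apply]
  exact Finset.sum_nonneg fun l _ => mul_nonneg
    (stieltjes_inv_nonneg _ hS (omega_off Ω₀ hΩ₀ σ S) i l) (hd l k)

theorem omega_trace_diff {n : ℕ} (Ω₀ : Matrix (Fin n) (Fin n) ℝ)
    (σ : ℝ) (S : Finset (Fin n)) (v : Fin n) (hv : v ∉ S) (hS : (OmegaId Ω₀ σ S).PosDef)
    (hT : (OmegaId Ω₀ σ (insert v S)).PosDef) :
    (OmegaId Ω₀ σ S)⁻¹.trace - (OmegaId Ω₀ σ (insert v S))⁻¹.trace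
      = (σ ^ 2)⁻¹ * ∑ k, (OmegaId Ω₀ σ (insert v S))⁻¹ v k * (OmegaId Ω₀ σ S)⁻¹ k v := by
  have hd : OmegaId Ω₀ σ (insert v S) - OmegaId Ω₀ σ S
      = (σ ^ 2)⁻¹ • Matrix.single v v (1 : ℝ) := by
    rw [OmegaId, OmegaId, Finset.sum_insert hv, smul_add]
    abel
  rw [← Matrix.trace_sub, inv_sub_inv_aux _ _ hS hT, hd, Matrix.mul_smul, Matrix.smul_mul,
    Matrix.trace_smul, smul_eq_mul, Matrix.trace_mul_comm, ← Matrix.mul_assoc,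
    Matrix.trace_mul_single, ← Matrix.mul_apply]
  simp

/-- with `C = I` and a Stieltjes regularizer `Ω₀`, the objective
`f(S) = tr(Ω(S)⁻¹)` is supermodular on nonempty sets: for all nonempty
`S ⊆ T` and `v ∉ T`, `f(S) − f(S ∪ {v}) ≥ f(T) − f(T ∪ {v})`. -/
theorem trace_inv_supermodular {n : ℕ}
    (Ω₀ : Matrix (Fin n) (Fin n) ℝ) (hΩ₀ : IsStieltjes Ω₀)
    (σ : ℝ) (hσ : 0 < σ)
    (hpd : ∀ S : Finset (Fin n), S.Nonempty → (OmegaId Ω₀ σ S).PosDef)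
    (S T : Finset (Fin n)) (hS : S.Nonempty) (hST : S ⊆ T)
    (v : Fin n) (hv : v ∉ T) :
    (OmegaId Ω₀ σ T)⁻¹.trace - (OmegaId Ω₀ σ (insert v T))⁻¹.trace
      ≤ (OmegaId Ω₀ σ S)⁻¹.trace - (OmegaId Ω₀ σ (insert v S))⁻¹.trace := by
  have hT : T.Nonempty := hS.mono hST
  have hS' : (insert v S).Nonempty := Finset.insert_nonempty _ _
  have hT' : (insert v T).Nonempty := Finset.insert_nonempty _ _
  rw [omega_trace_diff Ω₀ σ T v hv (hpd _ hT) (hpd _ hT'),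
    omega_trace_diff Ω₀ σ S v (fun h => hv (hST h)) (hpd _ hS) (hpd _ hS')]
  refine mul_le_mul_of_nonneg_left (Finset.sum_le_sum fun k _ => ?_) (by positivity)
  exact mul_le_mul
    (omega_inv_mono Ω₀ hΩ₀ σ _ _ (Finset.insert_subset_insert v hST) (hpd _ hS') (hpd _ hT') v k)
    (omega_inv_mono Ω₀ hΩ₀ σ _ _ hST (hpd _ hS) (hpd _ hT) k v)
    (stieltjes_inv_nonneg _ (hpd _ hT) (omega_off Ω₀ hΩ₀ σ T) k v)
    (stieltjes_inv_nonneg _ (hpd _ hS') (omega_off Ω₀ hΩ₀ σ _) v k)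
end

section
/- Let Ω be a positive definite Stieltjes n×n matrix, σ > 0, and let u ≠ v be indices in {1,…,n}. Set Σ = Ω⁻¹ and Σ' = (Ω + σ⁻² e_u e_uᵀ)⁻¹. Then ‖Σ_v‖² / (σ² + Σ_vv) ≥ ‖Σ'_v‖² / (σ² + Σ'_vv), where Σ_v denotes the v-th row of Σ and Σ_vv its (v,v) entry. -/
open Matrix

lemma min_principle {n : ℕ} (Ω : Matrix (Fin n) (Fin n) ℝ) (hΩ : Ω.PosDef)
    (hoff : ∀ i j, i ≠ j → Ω i j ≤ 0) (x : Fin n → ℝ)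
    (hx : ∀ i, x i < 0 → 0 ≤ (Ω *ᵥ x) i) (i : Fin n) : 0 ≤ x i := by
  set m : Fin n → ℝ := fun i => max (-x i) 0 with hm
  have hm0 : ∀ i, 0 ≤ m i := fun i => le_max_right _ _
  have h1 : 0 ≤ m ⬝ᵥ (Ω *ᵥ x) := by
    apply Finset.sum_nonneg
    intro i _
    rcases lt_or_ge (x i) 0 with h | h
    · exact mul_nonneg (hm0 i) (hx i h)
    · have : m i = 0 := by simp [hm, h]
      simp [this]
  have h2 : m ⬝ᵥ (Ω *ᵥ (x + m)) ≤ 0 := by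
    apply Finset.sum_nonpos
    intro i _
    simp only [Matrix.mulVec, dotProduct, Finset.mul_sum]
    apply Finset.sum_nonpos
    intro j _
    have hp : 0 ≤ (x + m) j := by
      have : -x j ≤ m j := le_max_left _ _
      simp only [Pi.add_apply]; linarith
    by_cases hij : i = j
    · subst hij
      have : m i * (x + m) i = 0 := by
        simp only [Pi.add_apply, hm]
        rcases le_total (-x i) 0 with h | h
        · rw [max_eq_right h]; ring
        · rw [max_eq_left h]; ring
      have : m i * (Ω i i * (x + m) i) = 0 := by
        rw [mul_left_comm, this, mul_zero]
      exact this.le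
    · exact mul_nonpos_of_nonneg_of_nonpos (hm0 i)
        (mul_nonpos_of_nonpos_of_nonneg (hoff i j hij) hp)
  rw [Matrix.mulVec_add, dotProduct_add] at h2
  have h3 : m = 0 := by
    by_contra hne
    have := hΩ.dotProduct_mulVec_pos hne
    simp only [star_trivial] at this
    linarith
  have h4 : -x i ≤ m i := le_max_left _ _
  rw [h3] at h4
  simp at h4
  exact h4

theorem row_ratio_antitone_of_diag_update {n : ℕ}
    (Ω : Matrix (Fin n) (Fin n) ℝ) (hSt : IsStieltjes Ω) (hΩ : Ω.PosDef)
    (σ : ℝ) (hσ : 0 < σ) (u v : Fin n) (huv : u ≠ v) :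
    (∑ j, ((Ω + (σ ^ 2)⁻¹ • Matrix.single u u (1 : ℝ))⁻¹ v j) ^ 2)
        / (σ ^ 2 + (Ω + (σ ^ 2)⁻¹ • Matrix.single u u (1 : ℝ))⁻¹ v v)
      ≤ (∑ j, (Ω⁻¹ v j) ^ 2) / (σ ^ 2 + Ω⁻¹ v v) := by
  have hoff := hSt.2
  have hdet : IsUnit Ω.det := hΩ.det_pos.ne'.isUnit
  set S := Ω⁻¹ with hS
  have hSpd : S.PosDef := hΩ.inv
  have hsym : ∀ i j, S i j = S j i := fun i j => by
    have := hSpd.isHermitian.apply i j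
    simpa using this.symm
  have hmul : Ω * S = 1 := Matrix.mul_nonsing_inv Ω hdet
  have hcol : ∀ j i, (Ω *ᵥ (fun k => S k j)) i = (1 : Matrix (Fin n) (Fin n) ℝ) i j := by
    intro j i
    rw [← hmul]; rfl
  have hnn : ∀ i j, 0 ≤ S i j := by
    intro i j
    refine min_principle Ω hΩ hoff (fun k => S k j) ?_ i
    intro i _
    rw [hcol, Matrix.one_apply]; split_ifs <;> norm_num
  have hpos : ∀ i, 0 < S i i := fun i => hSpd.diag_pos
  have hpath : ∀ j, S u v * S v j ≤ S u j * S v v := by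
    intro j
    have := min_principle Ω hΩ hoff
      (S v v • (fun k => S k j) - S v j • (fun k => S k v)) ?_ u
    · simp at this; linarith
    · intro i hi
      have hiv : i ≠ v := by
        rintro rfl
        simp [mul_comm] at hi
      rw [Matrix.mulVec_sub, Matrix.mulVec_smul, Matrix.mulVec_smul]
      simp only [Pi.sub_apply, Pi.smul_apply, hcol, smul_eq_mul]
      rw [Matrix.one_apply_ne hiv, Matrix.one_apply]
      have := hpos v
      split_ifs <;> simp [this.le]
  have hs : 0 < σ ^ 2 := by positivity
  generalize σ ^ 2 = s at hs ⊢
  have hsd : 0 < s + S u u := add_pos hs (hpos u)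
  set c := S u v / (s + S u u) with hc
  have hc0 : 0 ≤ c := div_nonneg (hnn _ _) hsd.le
  -- Sherman-Morrison
  have hSM : (Ω + s⁻¹ • Matrix.single u u (1 : ℝ))⁻¹
      = S - (s + S u u)⁻¹ • Matrix.vecMulVec (fun i => S i u) (fun j => S u j) := by
    apply Matrix.inv_eq_right_inv
    have e1 : Ω * Matrix.vecMulVec (fun i => S i u) (fun j => S u j)
        = Matrix.single u u 1 * S := by
      ext i j
      rw [Matrix.mul_vecMulVec, Matrix.vecMulVec_apply, hcol]
      by_cases h : i = u
      · subst h; simp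
      · simp [h]
    have e2 : Matrix.single u u (1:ℝ) * Matrix.vecMulVec (fun i => S i u) (fun j => S u j)
        = S u u • (Matrix.single u u 1 * S) := by
      ext i j
      by_cases h : i = u
      · subst h; simp [Matrix.vecMulVec_apply]
      · simp [h]
    rw [add_mul, mul_sub, mul_sub, hmul, Matrix.mul_smul, e1, Matrix.mul_smul, Matrix.smul_mul,
      Matrix.smul_mul, e2]
    ext i j
    simp only [Matrix.add_apply, Matrix.sub_apply, Matrix.smul_apply, smul_eq_mul]
    field_simp
    ring
  have hrow : ∀ j, (Ω + s⁻¹ • Matrix.single u u (1 : ℝ))⁻¹ v j = S v j - c * S u j := by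
    intro j
    rw [hSM]
    simp only [Matrix.sub_apply, Matrix.smul_apply, Matrix.vecMulVec_apply, smul_eq_mul, hc,
      hsym v u]
    ring
  have hynn : ∀ j, 0 ≤ S v j - c * S u j := by
    intro j
    have := min_principle Ω hΩ hoff ((fun k => S k v) - c • (fun k => S k u)) ?_ j
    · simpa [hsym v j, hsym u j] using this
    · intro i hi
      have hiu : i ≠ u := by
        rintro rfl
        simp only [Pi.sub_apply, Pi.smul_apply, smul_eq_mul, hc] at hi
        have h1 : S i v - S i v / (s + S i i) * S i i = S i v * s / (s + S i i) := by
          field_simp; ring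
        have h2 : 0 ≤ S i v * s / (s + S i i) :=
          div_nonneg (mul_nonneg (hnn _ _) hs.le) hsd.le
        linarith
      rw [Matrix.mulVec_sub, Matrix.mulVec_smul]
      simp only [Pi.sub_apply, Pi.smul_apply, hcol, smul_eq_mul]
      rw [Matrix.one_apply_ne hiu, Matrix.one_apply]
      split_ifs <;> simp
  simp only [hrow]
  have ha := hpos v
  set a := S v v with haa
  set r := (a - c * S u v) / a with hr
  have har : a - c * S u v = a * r := by rw [hr]; field_simp
  have hr0 : 0 ≤ r := div_nonneg (hynn v) ha.le
  have hr1 : r ≤ 1 := by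
    rw [hr, div_le_one ha]
    have := mul_nonneg hc0 (hnn u v)
    linarith
  have hle : ∀ j, S v j - c * S u j ≤ r * S v j := by
    intro j
    have h := mul_le_mul_of_nonneg_left (hpath j) hc0
    have : a * (S v j - c * S u j) ≤ a * (r * S v j) := by
      rw [← mul_assoc, ← har]; nlinarith
    exact le_of_mul_le_mul_left this ha
  have hsum : ∑ j, (S v j - c * S u j) ^ 2 ≤ r ^ 2 * ∑ j, S v j ^ 2 := by
    rw [Finset.mul_sum]
    apply Finset.sum_le_sum
    intro j _
    rw [← mul_pow]
    exact pow_le_pow_left₀ (hynn j) (hle j) 2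
  have hQ : 0 ≤ ∑ j, S v j ^ 2 := Finset.sum_nonneg fun j _ => sq_nonneg _
  rw [har]
  rw [div_le_div_iff₀ (by positivity) (by positivity)]
  have hk : r ^ 2 * (s + a) ≤ s + a * r := by
    have : r ^ 2 ≤ r := by nlinarith
    nlinarith
  calc _ ≤ (r ^ 2 * ∑ j, S v j ^ 2) * (s + a) :=
        mul_le_mul_of_nonneg_right hsum (by positivity)
    _ = (∑ j, S v j ^ 2) * (r ^ 2 * (s + a)) := by ring
    _ ≤ _ := mul_le_mul_of_nonneg_left hk hQ
end

section
/- Let Ω be a positive definite Stieltjes n×n matrix, σ > 0, and u an index in {1,…,n}. Then the inverse of the rank-one diagonal update is entrywise dominated by the original inverse: (Ω + σ⁻² e_u e_uᵀ)⁻¹ ≤ Ω⁻¹ entrywise, i.e., every entry of (Ω + σ⁻² e_u e_uᵀ)⁻¹ is at most the corresponding entry of Ω⁻¹, and both inverses have all entries non-negative. -/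
open Matrix

theorem aux_nonneg {n : ℕ} (A : Matrix (Fin n) (Fin n) ℝ) (hA : A.PosDef)
    (ho : ∀ i j, i ≠ j → A i j ≤ 0) (x : Fin n → ℝ) (hx : ∀ i, 0 ≤ (A *ᵥ x) i) (k : Fin n) :
    0 ≤ x k := by
  set y : Fin n → ℝ := fun i => max (-x i) 0 with hy
  have hy0 : y = 0 := by
    by_contra hne
    have h1 := hA.dotProduct_mulVec_pos hne
    have h2 : 0 ≤ y ⬝ᵥ (A *ᵥ x) :=
      Finset.sum_nonneg fun i _ => mul_nonneg (le_max_right _ _) (hx i)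
    have h3 : y ⬝ᵥ (A *ᵥ (x + y)) ≤ 0 := by
      simp only [dotProduct, mulVec, Finset.mul_sum]
      refine Finset.sum_nonpos fun i _ => Finset.sum_nonpos fun j _ => ?_
      have hyi : 0 ≤ y i := le_max_right _ _
      have hp : 0 ≤ (x + y) j := by
        have : -x j ≤ y j := le_max_left _ _
        simp only [Pi.add_apply]; linarith
      by_cases hij : i = j
      · subst hij
        have : y i * (x + y) i = 0 := by
          simp only [Pi.add_apply, hy]
          rcases le_total (-x i) 0 with h | h
          · rw [max_eq_right h]; ring
          · rw [max_eq_left h]; ring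
        have h4 : y i * (A i i * (x + y) i) = A i i * (y i * (x + y) i) := by ring
        rw [h4, this, mul_zero]
      · exact mul_nonpos_of_nonneg_of_nonpos hyi
          (mul_nonpos_of_nonpos_of_nonneg (ho i j hij) hp)
    rw [mulVec_add, dotProduct_add] at h3
    simp only [star_trivial] at h1
    linarith
  have h5 : -x k ≤ y k := le_max_left _ _
  rw [hy0] at h5
  simp only [Pi.zero_apply] at h5
  linarith

theorem aux_inv_nonneg {n : ℕ} (A : Matrix (Fin n) (Fin n) ℝ) (hA : A.PosDef)
    (ho : ∀ i j, i ≠ j → A i j ≤ 0) (i j : Fin n) : 0 ≤ A⁻¹ i j := by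
  refine aux_nonneg A hA ho (fun k => A⁻¹ k j) (fun k => ?_) i
  have h : (A *ᵥ fun k => A⁻¹ k j) k = (A * A⁻¹) k j := rfl
  rw [h, mul_nonsing_inv _ ((isUnit_iff_isUnit_det _).1 hA.isUnit), one_apply]
  split_ifs <;> norm_num

/-- for a positive definite Stieltjes matrix `Ω`, `σ > 0` and an
index `u`, the inverse of the rank-one diagonal update is entrywise dominated
by the original inverse, and both inverses are entrywise non-negative. -/
theorem inv_rank_one_update_entrywise_le {n : ℕ}
    (Ω : Matrix (Fin n) (Fin n) ℝ) (hSt : IsStieltjes Ω) (hΩ : Ω.PosDef)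
    (σ : ℝ) (hσ : 0 < σ) (u : Fin n) :
    (∀ i j, (Ω + (σ ^ 2)⁻¹ • Matrix.single u u (1 : ℝ))⁻¹ i j ≤ Ω⁻¹ i j)
      ∧ (∀ i j, 0 ≤ (Ω + (σ ^ 2)⁻¹ • Matrix.single u u (1 : ℝ))⁻¹ i j)
      ∧ (∀ i j, 0 ≤ Ω⁻¹ i j) := by
  have hc : 0 ≤ (σ ^ 2)⁻¹ := by positivity
  have hE : ∀ i j, 0 ≤ ((σ ^ 2)⁻¹ • Matrix.single u u (1 : ℝ)) i j := by
    intro i j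
    rw [Matrix.smul_apply, Matrix.single_apply]
    split_ifs <;> simp [hc]
  have hEp : ((σ ^ 2)⁻¹ • Matrix.single u u (1 : ℝ)).PosSemidef := by
    refine Matrix.PosSemidef.smul ?_ hc
    rw [← Matrix.diagonal_single]
    refine Matrix.PosSemidef.diagonal ?_
    simp
  have hB := hΩ.add_posSemidef hEp
  have hBo : ∀ i j, i ≠ j → (Ω + (σ ^ 2)⁻¹ • Matrix.single u u (1 : ℝ)) i j ≤ 0 := by
    intro i j hij
    have h0 : Matrix.single u u (1 : ℝ) i j = 0 := by
      rw [Matrix.single_apply, if_neg]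
      rintro ⟨rfl, rfl⟩
      exact hij rfl
    rw [Matrix.add_apply, Matrix.smul_apply, h0, smul_zero, add_zero]
    exact hSt.2 i j hij
  have h1 := aux_inv_nonneg _ hΩ hSt.2
  have h2 := aux_inv_nonneg _ hB hBo
  refine ⟨fun i j => ?_, h2, h1⟩
  have hΩu := (isUnit_iff_isUnit_det _).1 hΩ.isUnit
  have hBu := (isUnit_iff_isUnit_det _).1 hB.isUnit
  generalize (σ ^ 2)⁻¹ • Matrix.single u u (1 : ℝ) = E at *
  have key : Ω⁻¹ - (Ω + E)⁻¹ = Ω⁻¹ * E * (Ω + E)⁻¹ := by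
    have e1 : Ω⁻¹ * (Ω + E) * (Ω + E)⁻¹ = Ω⁻¹ := by
      rw [Matrix.mul_assoc, mul_nonsing_inv _ hBu, Matrix.mul_one]
    rw [Matrix.mul_add, nonsing_inv_mul _ hΩu, Matrix.add_mul, Matrix.one_mul] at e1
    exact sub_eq_of_eq_add' e1.symm
  have h3 : 0 ≤ (Ω⁻¹ - (Ω + E)⁻¹) i j := by
    rw [key, Matrix.mul_apply]
    refine Finset.sum_nonneg fun k _ => mul_nonneg ?_ (h2 k j)
    rw [Matrix.mul_apply]
    exact Finset.sum_nonneg fun l _ => mul_nonneg (h1 i l) (hE l k)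
  rw [Matrix.sub_apply] at h3
  linarith
end

section
/- Let Ω be a positive definite Stieltjes n×n matrix, σ > 0, and u, v indices in {1,…,n}. Set Σ = Ω⁻¹. Then the vector (σ² + Σ_vv) Σ_u − Σ_uv Σ_v is entrywise non-negative, where Σ_u and Σ_v denote the u-th and v-th rows of Σ. Equivalently, this vector equals (σ² + Σ_vv) times the u-th row of (Ω + σ⁻² e_v e_vᵀ)⁻¹, which is entrywise non-negative. -/
open Matrix

lemma stieltjes_inv_nonneg_aux {n : ℕ} (M : Matrix (Fin n) (Fin n) ℝ)
    (hM : M.PosDef) (ho : ∀ i j, i ≠ j → M i j ≤ 0) (u j : Fin n) : 0 ≤ M⁻¹ u j := by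
  have hdet : IsUnit M.det := (Matrix.isUnit_iff_isUnit_det M).1 hM.isUnit
  have h1 : M * M⁻¹ = 1 := Matrix.mul_nonsing_inv M hdet
  by_contra hneg
  push Not at hneg
  set x : Fin n → ℝ := fun i => M⁻¹ i j with hx
  set y : Fin n → ℝ := fun i => max (-x i) 0 with hy
  have hMx : ∀ i, 0 ≤ ∑ k, M i k * x k := by
    intro i
    have h2 := congrFun (congrFun h1 i) j
    rw [Matrix.mul_apply] at h2
    simp only [hx]
    rw [h2, Matrix.one_apply]
    split_ifs <;> norm_num
  have hyne : y ≠ 0 := by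
    intro h
    have h3 := congrFun h u
    simp only [hy, Pi.zero_apply] at h3
    have h4 := le_max_left (-x u) 0
    have : x u < 0 := hneg
    linarith
  have hpos := hM.dotProduct_mulVec_pos hyne
  have e : star y ⬝ᵥ (M *ᵥ y) = ∑ i, ∑ k, y i * (M i k * y k) := by
    simp [dotProduct, Matrix.mulVec, Finset.mul_sum]
  rw [e] at hpos
  have h5 : 0 ≤ ∑ i, ∑ k, y i * (M i k * x k) := by
    refine Finset.sum_nonneg fun i _ => ?_
    rw [← Finset.mul_sum]
    exact mul_nonneg (le_max_right _ _) (hMx i)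
  have h6 : ∑ i, ∑ k, y i * (M i k * x k) + ∑ i, ∑ k, y i * (M i k * y k) ≤ 0 := by
    rw [← Finset.sum_add_distrib]
    refine Finset.sum_nonpos fun i _ => ?_
    rw [← Finset.sum_add_distrib]
    refine Finset.sum_nonpos fun k _ => ?_
    have hyi : 0 ≤ y i := le_max_right _ _
    have hp : 0 ≤ x k + y k := by
      have := le_max_left (-x k) 0
      simp only [hy]; linarith
    have e2 : y i * (M i k * x k) + y i * (M i k * y k) = M i k * (y i * (x k + y k)) := by ring
    rw [e2]
    by_cases hik : i = k
    · subst hik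
      have : y i * (x i + y i) = 0 := by
        simp only [hy]
        rcases le_total (-x i) 0 with h | h
        · rw [max_eq_right h]; ring
        · rw [max_eq_left h]; ring
      rw [this, mul_zero]
    · exact mul_nonpos_of_nonpos_of_nonneg (ho i k hik) (mul_nonneg hyi hp)
  linarith

theorem stieltjes_row_combination_nonneg {n : ℕ}
    (Ω : Matrix (Fin n) (Fin n) ℝ) (hSt : IsStieltjes Ω) (hΩ : Ω.PosDef)
    (σ : ℝ) (hσ : 0 < σ) (u v : Fin n) :
    (∀ j, 0 ≤ (σ ^ 2 + Ω⁻¹ v v) * Ω⁻¹ u j - Ω⁻¹ u v * Ω⁻¹ v j)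
      ∧ (∀ j, (σ ^ 2 + Ω⁻¹ v v) * Ω⁻¹ u j - Ω⁻¹ u v * Ω⁻¹ v j
            = (σ ^ 2 + Ω⁻¹ v v) * (Ω + (σ ^ 2)⁻¹ • Matrix.single v v (1 : ℝ))⁻¹ u j)
      ∧ (∀ j, 0 ≤ (Ω + (σ ^ 2)⁻¹ • Matrix.single v v (1 : ℝ))⁻¹ u j) := by
  have hc : 0 < (σ ^ 2)⁻¹ := by positivity
  have hcs : (σ ^ 2)⁻¹ * σ ^ 2 = 1 := by field_simp
  have hB : (Ω + (σ ^ 2)⁻¹ • Matrix.single v v (1 : ℝ)).PosDef := by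
    refine hΩ.add_posSemidef (Matrix.PosSemidef.smul ?_ hc.le)
    have h := Matrix.posSemidef_vecMulVec_self_star (Pi.single v (1 : ℝ) : Fin n → ℝ)
    convert h using 1
    ext i k
    simp [Matrix.vecMulVec_apply, Matrix.single_apply, Pi.single_apply]
    grind
  have hT : ∀ i j, 0 ≤ (Ω + (σ ^ 2)⁻¹ • Matrix.single v v (1 : ℝ))⁻¹ i j := by
    refine stieltjes_inv_nonneg_aux _ hB fun i k hik => ?_
    have h0 : Matrix.single v v (1 : ℝ) i k = 0 := by
      rw [Matrix.single_apply]; grind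
    rw [Matrix.add_apply, Matrix.smul_apply, h0, smul_zero, add_zero]
    exact hSt.2 i k hik
  have hS := stieltjes_inv_nonneg_aux Ω hΩ hSt.2
  have hd1 : IsUnit Ω.det := (Matrix.isUnit_iff_isUnit_det _).1 hΩ.isUnit
  have hd2 := (Matrix.isUnit_iff_isUnit_det _).1 hB.isUnit
  have key : ∀ i j, (Ω + (σ ^ 2)⁻¹ • Matrix.single v v (1 : ℝ))⁻¹ i j + (σ ^ 2)⁻¹ *
      (Ω⁻¹ i v * (Ω + (σ ^ 2)⁻¹ • Matrix.single v v (1 : ℝ))⁻¹ v j) = Ω⁻¹ i j := by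
    intro i j
    have h1 := Matrix.mul_nonsing_inv _ hd2
    generalize (Ω + (σ ^ 2)⁻¹ • Matrix.single v v (1 : ℝ))⁻¹ = T at h1 ⊢
    have h2 : Ω⁻¹ * ((Ω + (σ ^ 2)⁻¹ • Matrix.single v v (1 : ℝ)) * T) = Ω⁻¹ := by
      rw [h1, mul_one]
    rw [add_mul, mul_add, ← mul_assoc, Matrix.nonsing_inv_mul _ hd1, one_mul,
      Matrix.smul_mul, Matrix.mul_smul] at h2
    have h3 := congrFun (congrFun h2 i) j
    rw [← h3, Matrix.add_apply, Matrix.smul_apply, smul_eq_mul]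
    congr 2
    rw [Matrix.mul_apply, Finset.sum_eq_single v]
    · simp
    · intro b _ hb
      simp [Matrix.single_mul_apply_of_ne, hb]
    · simp
  have heq : ∀ j, (σ ^ 2 + Ω⁻¹ v v) * Ω⁻¹ u j - Ω⁻¹ u v * Ω⁻¹ v j
            = (σ ^ 2 + Ω⁻¹ v v) * (Ω + (σ ^ 2)⁻¹ • Matrix.single v v (1 : ℝ))⁻¹ u j := by
    intro j
    have k1 := key u j
    have k2 := key v j
    rw [← k1]
    generalize (Ω + (σ ^ 2)⁻¹ • Matrix.single v v (1 : ℝ))⁻¹ = T at *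
    rw [← k2]
    linear_combination (Ω⁻¹ u v * T v j) * hcs
  refine ⟨fun j => ?_, heq, hT u⟩
  rw [heq]
  exact mul_nonneg (add_nonneg (by positivity) (hS v v)) (hT u j)
end

section
/- Let Ω₀ be a (possibly singular) Stieltjes n×n matrix and σ > 0; for S ⊆ {1,…,n} let Ω(S) = Ω₀ + σ⁻² Σ_{v∈S} e_v e_vᵀ, assume Ω(S) is positive definite for every nonempty S, and let f(S) = tr(Ω(S)⁻¹) for nonempty S. Let s ≥ 1, let S be the set of size s produced by the greedy algorithm that starts from the empty set and at each step adds the element v minimizing f(current set ∪ {v}), let S* be a minimizer of f over all subsets of size s, and let S₁* be a minimizer of f over singletons. Then f(S) − f(S*) ≤ (1 − 1/s)^{s−1} · (f(S₁*) − f(S*)). -/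
open Matrix

/-- The AG-SSL objective `f(S) = tr(Ω(S)⁻¹)`. -/
noncomputable def fObj {n : ℕ} (Ω₀ : Matrix (Fin n) (Fin n) ℝ) (σ : ℝ)
    (S : Finset (Fin n)) : ℝ :=
  (OmegaId Ω₀ σ S)⁻¹.trace


lemma inv_nonneg_aux {n : ℕ} (A : Matrix (Fin n) (Fin n) ℝ) (hA : A.PosDef)
    (hz : ∀ i j, i ≠ j → A i j ≤ 0) (x : Fin n → ℝ) (hx : ∀ i, 0 ≤ (A *ᵥ x) i) (i : Fin n) :
    0 ≤ x i := by
  by_contra hneg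
  push Not at hneg
  set y : Fin n → ℝ := fun i => max (-x i) 0 with hy
  have hy0 : ∀ i, 0 ≤ y i := fun i => le_max_right _ _
  have hyne : y ≠ 0 := by
    intro h
    have h1 : y i = 0 := congrFun h i
    have h2 : -x i ≤ y i := le_max_left _ _
    linarith
  have h1 : 0 < y ⬝ᵥ (A *ᵥ y) := by
    have := hA.dotProduct_mulVec_pos hyne
    simpa using this
  have h2 : 0 ≤ y ⬝ᵥ (A *ᵥ x) := Finset.sum_nonneg fun i _ => mul_nonneg (hy0 i) (hx i)
  have h3 : y ⬝ᵥ (A *ᵥ (y + x)) ≤ 0 := by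
    apply Finset.sum_nonpos
    intro a _
    rw [mulVec, dotProduct, Finset.mul_sum]
    apply Finset.sum_nonpos
    intro b _
    have hp : 0 ≤ y b + x b := by
      have : -x b ≤ y b := le_max_left _ _
      linarith
    by_cases hab : a = b
    · subst hab
      have : y a * (y a + x a) = 0 := by
        rcases le_total 0 (x a) with h | h
        · have : y a = 0 := max_eq_right (by linarith)
          rw [this]; ring
        · have : y a = -x a := max_eq_left (by linarith)
          rw [this]; ring
      have e : y a * (A a a * (y + x) a) = A a a * (y a * (y a + x a)) := by
        simp only [Pi.add_apply]; ring
      rw [e, this]; simp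
    · exact mul_nonpos_of_nonneg_of_nonpos (hy0 a)
        (mul_nonpos_of_nonpos_of_nonneg (hz a b hab) hp)
  rw [mulVec_add, dotProduct_add] at h3
  linarith

lemma inv_nonneg_entry {n : ℕ} (A : Matrix (Fin n) (Fin n) ℝ) (hA : A.PosDef)
    (hz : ∀ i j, i ≠ j → A i j ≤ 0) (i j : Fin n) : 0 ≤ A⁻¹ i j := by
  have hu : IsUnit A.det := (Matrix.isUnit_iff_isUnit_det A).1 hA.isUnit
  apply inv_nonneg_aux A hA hz (fun k => A⁻¹ k j)
  intro k
  have : (A *ᵥ fun k => A⁻¹ k j) k = (A * A⁻¹) k j := rfl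
  rw [this, Matrix.mul_nonsing_inv _ hu, Matrix.one_apply]
  split_ifs <;> norm_num

lemma omega_apply {n : ℕ} (Ω₀ : Matrix (Fin n) (Fin n) ℝ) (σ : ℝ) (S : Finset (Fin n))
    (i j : Fin n) : OmegaId Ω₀ σ S i j =
      Ω₀ i j + if i = j ∧ i ∈ S then (σ ^ 2)⁻¹ else 0 := by
  simp only [OmegaId, Matrix.add_apply, Matrix.smul_apply, Matrix.sum_apply, Matrix.single_apply,
    smul_eq_mul]
  congr 1
  by_cases h : i = j
  · subst h; simp
  · have : ∀ v ∈ S, (if v = i ∧ v = j then (1:ℝ) else 0) = 0 := by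
      intro v _
      rw [if_neg]
      rintro ⟨rfl, rfl⟩; exact h rfl
    rw [Finset.sum_congr rfl this]; simp [h]


lemma G_nonneg {n : ℕ} (Ω₀ : Matrix (Fin n) (Fin n) ℝ) (hΩ₀ : IsStieltjes Ω₀)
    (σ : ℝ)
    (hpd : ∀ S : Finset (Fin n), S.Nonempty → (OmegaId Ω₀ σ S).PosDef)
    (S : Finset (Fin n)) (hS : S.Nonempty) (i j : Fin n) :
    0 ≤ (OmegaId Ω₀ σ S)⁻¹ i j := by
  apply inv_nonneg_entry _ (hpd S hS)
  intro i j hij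
  rw [omega_apply]
  simpa [hij] using hΩ₀.2 i j hij

lemma G_sub {n : ℕ} (Ω₀ : Matrix (Fin n) (Fin n) ℝ) (σ : ℝ)
    (hpd : ∀ S : Finset (Fin n), S.Nonempty → (OmegaId Ω₀ σ S).PosDef)
    (S T : Finset (Fin n)) (hS : S.Nonempty) (hT : T.Nonempty) :
    (OmegaId Ω₀ σ S)⁻¹ - (OmegaId Ω₀ σ T)⁻¹ =
      (OmegaId Ω₀ σ S)⁻¹ * (OmegaId Ω₀ σ T - OmegaId Ω₀ σ S) * (OmegaId Ω₀ σ T)⁻¹ := by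
  have h1 := (Matrix.isUnit_iff_isUnit_det _).1 (hpd S hS).isUnit
  have h2 := (Matrix.isUnit_iff_isUnit_det _).1 (hpd T hT).isUnit
  rw [Matrix.mul_sub, Matrix.sub_mul, Matrix.nonsing_inv_mul _ h1, Matrix.mul_assoc,
    Matrix.mul_nonsing_inv _ h2, Matrix.mul_one, Matrix.one_mul]

lemma G_anti {n : ℕ} (Ω₀ : Matrix (Fin n) (Fin n) ℝ) (hΩ₀ : IsStieltjes Ω₀)
    (σ : ℝ)
    (hpd : ∀ S : Finset (Fin n), S.Nonempty → (OmegaId Ω₀ σ S).PosDef)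
    (S T : Finset (Fin n)) (hS : S.Nonempty) (hST : S ⊆ T) (i j : Fin n) :
    (OmegaId Ω₀ σ T)⁻¹ i j ≤ (OmegaId Ω₀ σ S)⁻¹ i j := by
  have hT := hS.mono hST
  rw [← sub_nonneg, ← Matrix.sub_apply, G_sub Ω₀ σ hpd S T hS hT, Matrix.mul_apply]
  refine Finset.sum_nonneg fun k _ => mul_nonneg ?_ (G_nonneg Ω₀ hΩ₀ σ hpd T hT _ _)
  rw [Matrix.mul_apply]
  refine Finset.sum_nonneg fun l _ => mul_nonneg (G_nonneg Ω₀ hΩ₀ σ hpd S hS _ _) ?_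
  rw [Matrix.sub_apply, omega_apply, omega_apply]
  have : 0 ≤ (σ ^ 2)⁻¹ := by positivity
  by_cases h : l = k ∧ l ∈ S
  · rw [if_pos h, if_pos ⟨h.1, hST h.2⟩]; simp
  · rw [if_neg h]; split_ifs <;> linarith

lemma f_anti {n : ℕ} (Ω₀ : Matrix (Fin n) (Fin n) ℝ) (hΩ₀ : IsStieltjes Ω₀)
    (σ : ℝ)
    (hpd : ∀ S : Finset (Fin n), S.Nonempty → (OmegaId Ω₀ σ S).PosDef)
    (S T : Finset (Fin n)) (hS : S.Nonempty) (hST : S ⊆ T) :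
    fObj Ω₀ σ T ≤ fObj Ω₀ σ S := by
  unfold fObj Matrix.trace
  exact Finset.sum_le_sum fun i _ => G_anti Ω₀ hΩ₀ σ hpd S T hS hST i i

lemma f_step {n : ℕ} (Ω₀ : Matrix (Fin n) (Fin n) ℝ) (σ : ℝ)
    (hpd : ∀ S : Finset (Fin n), S.Nonempty → (OmegaId Ω₀ σ S).PosDef)
    (S : Finset (Fin n)) (hS : S.Nonempty) (v : Fin n) (hv : v ∉ S) :
    fObj Ω₀ σ S - fObj Ω₀ σ (insert v S) = (σ ^ 2)⁻¹ *
      ∑ i, (OmegaId Ω₀ σ S)⁻¹ i v * (OmegaId Ω₀ σ (insert v S))⁻¹ v i := by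
  have hd : OmegaId Ω₀ σ (insert v S) - OmegaId Ω₀ σ S = (σ ^ 2)⁻¹ • Matrix.single v v (1:ℝ) := by
    simp only [OmegaId, Finset.sum_insert hv, smul_add]; abel
  rw [fObj, fObj, ← Matrix.trace_sub, G_sub Ω₀ σ hpd S _ hS (Finset.insert_nonempty _ _), hd,
    Matrix.trace, Finset.mul_sum]
  refine Finset.sum_congr rfl fun i _ => ?_
  simp [Matrix.mul_apply, Matrix.single_apply, ite_and, mul_assoc, mul_left_comm]

lemma f_super {n : ℕ} (Ω₀ : Matrix (Fin n) (Fin n) ℝ) (hΩ₀ : IsStieltjes Ω₀)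
    (σ : ℝ)
    (hpd : ∀ S : Finset (Fin n), S.Nonempty → (OmegaId Ω₀ σ S).PosDef)
    (S T : Finset (Fin n)) (hS : S.Nonempty) (hST : S ⊆ T) (v : Fin n) (hv : v ∉ T) :
    fObj Ω₀ σ T - fObj Ω₀ σ (insert v T) ≤ fObj Ω₀ σ S - fObj Ω₀ σ (insert v S) := by
  rw [f_step Ω₀ σ hpd T (hS.mono hST) v hv, f_step Ω₀ σ hpd S hS v (fun h => hv (hST h))]
  refine mul_le_mul_of_nonneg_left (Finset.sum_le_sum fun i _ => ?_) (by positivity)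
  exact mul_le_mul (G_anti Ω₀ hΩ₀ σ hpd S T hS hST _ _)
    (G_anti Ω₀ hΩ₀ σ hpd _ _ (Finset.insert_nonempty _ _) (Finset.insert_subset_insert v hST) _ _)
    (G_nonneg Ω₀ hΩ₀ σ hpd _ (Finset.insert_nonempty _ _) _ _) (G_nonneg Ω₀ hΩ₀ σ hpd _ hS _ _)

lemma f_union {n : ℕ} (Ω₀ : Matrix (Fin n) (Fin n) ℝ) (hΩ₀ : IsStieltjes Ω₀)
    (σ : ℝ)
    (hpd : ∀ S : Finset (Fin n), S.Nonempty → (OmegaId Ω₀ σ S).PosDef)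
    (S : Finset (Fin n)) (hS : S.Nonempty) (D : ℝ) (hD0 : 0 ≤ D)
    (hD : ∀ v ∉ S, fObj Ω₀ σ S - fObj Ω₀ σ (insert v S) ≤ D) (T : Finset (Fin n)) :
    fObj Ω₀ σ S - fObj Ω₀ σ (S ∪ T) ≤ T.card * D := by
  induction T using Finset.induction_on with
  | empty => simp
  | insert v T hv ih =>
    rw [Finset.card_insert_of_notMem hv, Finset.union_insert]
    push_cast
    by_cases h : v ∈ S ∪ T
    · rw [Finset.insert_eq_of_mem h]; linarith
    · have h1 := f_super Ω₀ hΩ₀ σ hpd S (S ∪ T) hS Finset.subset_union_left v h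
      have h2 := hD v (fun h' => h (Finset.mem_union_left _ h'))
      linarith

/-- classical greedy guarantee for the AG-SSL objective.
`Sc` is the chain of sets produced by the greedy algorithm (starting from the
empty set, at each of `s` steps adding a new element minimizing `f` of the
augmented set); `Sopt` is an optimal set of size `s` and `S1` an optimal
singleton.  Then `f(Sc s) − f(Sopt) ≤ (1 − 1/s)^(s−1) (f(S1) − f(Sopt))`. -/
theorem greedy_guarantee {n : ℕ}
    (Ω₀ : Matrix (Fin n) (Fin n) ℝ) (hΩ₀ : IsStieltjes Ω₀)
    (σ : ℝ) (hσ : 0 < σ)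
    (hpd : ∀ S : Finset (Fin n), S.Nonempty → (OmegaId Ω₀ σ S).PosDef)
    (s : ℕ) (hs : 1 ≤ s)
    (Sc : ℕ → Finset (Fin n))
    (hSc0 : Sc 0 = ∅)
    (hScStep : ∀ k < s, ∃ v ∉ Sc k,
        Sc (k + 1) = insert v (Sc k) ∧
        ∀ w ∉ Sc k, fObj Ω₀ σ (insert v (Sc k)) ≤ fObj Ω₀ σ (insert w (Sc k)))
    (Sopt : Finset (Fin n)) (hSoptCard : Sopt.card = s)
    (hSopt : ∀ T : Finset (Fin n), T.card = s → fObj Ω₀ σ Sopt ≤ fObj Ω₀ σ T)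
    (S1 : Finset (Fin n)) (hS1Card : S1.card = 1)
    (hS1 : ∀ T : Finset (Fin n), T.card = 1 → fObj Ω₀ σ S1 ≤ fObj Ω₀ σ T) :
    fObj Ω₀ σ (Sc s) - fObj Ω₀ σ Sopt
      ≤ (1 - 1 / (s : ℝ)) ^ (s - 1) * (fObj Ω₀ σ S1 - fObj Ω₀ σ Sopt) := by
  have key : ∀ k, k + 1 ≤ s → (Sc (k + 1)).Nonempty ∧
      fObj Ω₀ σ (Sc (k + 1)) - fObj Ω₀ σ Sopt
        ≤ (1 - 1 / (s : ℝ)) ^ k * (fObj Ω₀ σ S1 - fObj Ω₀ σ Sopt) := by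
    have hs1 : (1 : ℝ) ≤ s := by exact_mod_cast hs
    have hspos : (0 : ℝ) < s := by linarith
    intro k
    induction k with
    | zero =>
      intro h
      obtain ⟨v, hv, he, hmin⟩ := hScStep 0 h
      refine ⟨by rw [he]; exact Finset.insert_nonempty _ _, ?_⟩
      obtain ⟨w, rfl⟩ := Finset.card_eq_one.1 hS1Card
      have := hmin w (by simp [hSc0])
      rw [he]
      rw [hSc0] at this ⊢
      simp only [insert_empty_eq] at this ⊢
      simpa using this
    | succ k ih =>
      intro h
      obtain ⟨hne, hk⟩ := ih (by omega)
      obtain ⟨v, hv, he, hmin⟩ := hScStep (k + 1) h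
      refine ⟨by rw [he]; exact Finset.insert_nonempty _ _, ?_⟩
      have hu := f_union Ω₀ hΩ₀ σ hpd (Sc (k+1)) hne
        (fObj Ω₀ σ (Sc (k+1)) - fObj Ω₀ σ (Sc (k+1+1)))
        (by rw [he]; exact sub_nonneg.2 (f_anti Ω₀ hΩ₀ σ hpd _ _ hne (Finset.subset_insert _ _)))
        (by intro w hw; rw [he]; linarith [hmin w hw]) Sopt
      have hoptne : Sopt.Nonempty := Finset.card_pos.1 (by omega)
      have hm := f_anti Ω₀ hΩ₀ σ hpd Sopt (Sc (k+1) ∪ Sopt) hoptne Finset.subset_union_right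
      rw [hSoptCard] at hu
      have h0 : 0 ≤ 1 - 1 / (s : ℝ) := by
        rw [sub_nonneg, div_le_one hspos]; exact hs1
      have hstep : fObj Ω₀ σ (Sc (k+1+1)) - fObj Ω₀ σ Sopt ≤
          (1 - 1 / (s : ℝ)) * (fObj Ω₀ σ (Sc (k+1)) - fObj Ω₀ σ Sopt) := by
        have h3 : (fObj Ω₀ σ (Sc (k+1)) - fObj Ω₀ σ Sopt) / s ≤
            fObj Ω₀ σ (Sc (k+1)) - fObj Ω₀ σ (Sc (k+1+1)) := by
          rw [div_le_iff₀ hspos]; linarith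
        have h4 : (1 - 1 / (s : ℝ)) * (fObj Ω₀ σ (Sc (k+1)) - fObj Ω₀ σ Sopt) =
          (fObj Ω₀ σ (Sc (k+1)) - fObj Ω₀ σ Sopt) -
            (fObj Ω₀ σ (Sc (k+1)) - fObj Ω₀ σ Sopt) / s := by ring
        linarith
      have h5 := mul_le_mul_of_nonneg_left hk h0
      rw [pow_succ', mul_assoc]
      exact hstep.trans h5
  obtain ⟨m, rfl⟩ : ∃ m, s = m + 1 := ⟨s - 1, by omega⟩
  exact (key m le_rfl).2
end

section
/- Let Ω be a real symmetric positive definite n×n matrix, σ > 0, and v an index in {1,…,n}. Set Σ = Ω⁻¹, f = tr Σ, and f' = tr((Ω + σ⁻² e_v e_vᵀ)⁻¹). Then f − f' = ‖Σ_v‖² / (σ² + Σ_vv) ≥ 0, where Σ_v denotes the v-th row of Σ and Σ_vv its (v,v) entry; in particular the trace of the inverse strictly decreases whenever the row Σ_v is nonzero. -/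
open Matrix

/-- for symmetric positive definite `Ω`, `σ > 0` and an index
`v`, with `Σ = Ω⁻¹`, the trace of the inverse decreases under the rank-one
diagonal update by exactly `‖Σ_v‖² / (σ² + Σ_vv) ≥ 0`, with strict decrease
whenever the row `Σ_v` is nonzero. -/
theorem trace_decrease_identity_measurement {n : ℕ}
    (Ω : Matrix (Fin n) (Fin n) ℝ) (hΩ : Ω.PosDef)
    (σ : ℝ) (hσ : 0 < σ) (v : Fin n) :
    Ω⁻¹.trace - (Ω + (σ ^ 2)⁻¹ • Matrix.single v v (1 : ℝ))⁻¹.trace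
        = (∑ j, (Ω⁻¹ v j) ^ 2) / (σ ^ 2 + Ω⁻¹ v v)
      ∧ 0 ≤ (∑ j, (Ω⁻¹ v j) ^ 2) / (σ ^ 2 + Ω⁻¹ v v)
      ∧ ((∃ j, Ω⁻¹ v j ≠ 0) →
          (Ω + (σ ^ 2)⁻¹ • Matrix.single v v (1 : ℝ))⁻¹.trace < Ω⁻¹.trace) := by
  have hSpd : (Ω⁻¹).PosDef := hΩ.inv
  have hu : IsUnit Ω.det := hΩ.det_pos.ne'.isUnit
  have hmul : Ω * Ω⁻¹ = 1 := Matrix.mul_nonsing_inv Ω hu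
  generalize Ω⁻¹ = S at *
  have hsymm : ∀ i j, S i j = S j i := fun i j => by
    have := hSpd.isHermitian.apply j i
    simpa using this
  have hs : 0 < S v v := hSpd.diag_pos
  have hden : 0 < σ ^ 2 + S v v := by positivity
  have hESE : Matrix.single v v (1 : ℝ) * S * Matrix.single v v (1 : ℝ)
      = S v v • Matrix.single v v (1 : ℝ) := by
    simp
  have hinv : (Ω + (σ ^ 2)⁻¹ • Matrix.single v v (1 : ℝ))⁻¹
      = S - (σ ^ 2 + S v v)⁻¹ • (S * Matrix.single v v (1 : ℝ) * S) := by
    apply Matrix.inv_eq_right_inv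
    generalize Matrix.single v v (1 : ℝ) = E at *
    have h1 : Ω * (S * E * S) = E * S := by
      rw [← Matrix.mul_assoc, ← Matrix.mul_assoc, hmul, Matrix.one_mul]
    have h2 : E * (S * E * S) = S v v • (E * S) := by
      rw [← Matrix.mul_assoc, ← Matrix.mul_assoc, hESE, Matrix.smul_mul]
    rw [Matrix.add_mul, Matrix.mul_sub, Matrix.mul_sub, Matrix.mul_smul, Matrix.mul_smul,
      Matrix.smul_mul, Matrix.smul_mul, h1, h2, hmul]
    have h3 : (σ ^ 2)⁻¹ = (σ ^ 2 + S v v)⁻¹ + (σ ^ 2 + S v v)⁻¹ * ((σ ^ 2)⁻¹ * S v v) := by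
      field_simp
    ext i j
    simp only [Matrix.add_apply, Matrix.sub_apply, Matrix.smul_apply, smul_eq_mul]
    linear_combination (E * S) i j * h3
  have htr : (S * Matrix.single v v (1 : ℝ) * S).trace = ∑ j, (S v j) ^ 2 := by
    rw [Matrix.trace]
    refine Finset.sum_congr rfl fun j _ => ?_
    rw [Matrix.diag_apply, Matrix.mul_apply, Finset.sum_eq_single v]
    · simp [hsymm j v, sq]
    · intro b _ hb
      simp [hb]
    · simp
  have hmain : S.trace - (Ω + (σ ^ 2)⁻¹ • Matrix.single v v (1 : ℝ))⁻¹.trace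
        = (∑ j, (S v j) ^ 2) / (σ ^ 2 + S v v) := by
    rw [hinv, Matrix.trace_sub, Matrix.trace_smul, htr, smul_eq_mul]
    ring
  refine ⟨hmain, by positivity, ?_⟩
  rintro ⟨j, hj⟩
  have hpos : 0 < ∑ j, (S v j) ^ 2 :=
    Finset.sum_pos' (fun _ _ => sq_nonneg _) ⟨j, Finset.mem_univ _, by positivity⟩
  have := div_pos hpos hden
  linarith
end
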